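/- Let ρ be an everywhere-positive probability density on ℝ^d that is C² , let D : ℝ^d → ℝ^{d×d} be C¹ with D(x) symmetric positive semidefinite, and let s : ℝ^d → ℝ^d be C¹. Assume the decay condition ∫_{ℝ^d} ∇·(ρ(x) D(x) s(x)) dx = 0 and that all integrals below are finite. Then ∫_{ℝ^d} ( ⟨s(x), D(x) s(x)⟩ + 2 ∇·(D(x) s(x)) ) ρ(x) dx = ∫_{ℝ^d} ⟨s(x) − ∇log ρ(x), D(x)(s(x) − ∇log ρ(x))⟩ ρ(x) dx − ∫_{ℝ^d} ⟨∇log ρ(x), D(x) ∇log ρ(x)⟩ ρ(x) dx. In particular, minimizing the left-hand side over s is equivalent to minimizing the D-weighted score-matching error to ∇log ρ. -/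

import Mathlib

open MeasureTheory Matrix Filter
open scoped Topology

noncomputable section

/-- The gradient of a scalar field on `Fin d → ℝ`. -/
def grad {d : ℕ} (f : (Fin d → ℝ) → ℝ) (x : Fin d → ℝ) : Fin d → ℝ :=
  fun i => fderiv ℝ f x (Pi.single i 1)

/-- The divergence of a vector field on `Fin d → ℝ`. -/
def dvg {d : ℕ} (F : (Fin d → ℝ) → (Fin d → ℝ)) (x : Fin d → ℝ) : ℝ :=
  ∑ i, fderiv ℝ F x (Pi.single i 1) i

theorem grad_log {d : ℕ} {ρ : (Fin d → ℝ) → ℝ} {x : Fin d → ℝ}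
    (hρ : DifferentiableAt ℝ ρ x) (hx : ρ x ≠ 0) :
    grad (fun y => Real.log (ρ y)) x = (ρ x)⁻¹ • grad ρ x := by
  ext i
  simp [grad, fderiv.log hρ hx]

theorem dvg_smul {d : ℕ} {ρ : (Fin d → ℝ) → ℝ} {F : (Fin d → ℝ) → (Fin d → ℝ)}
    {x : Fin d → ℝ} (hρ : DifferentiableAt ℝ ρ x) (hF : DifferentiableAt ℝ F x) :
    dvg (fun y => ρ y • F y) x = ρ x * dvg F x + grad ρ x ⬝ᵥ F x := by
  simp [dvg, grad, fderiv_fun_smul hρ hF, dotProduct, Finset.sum_add_distrib, Finset.mul_sum]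

theorem sub_dotProduct_mulVec_sub {n R : Type*} [Fintype n] [CommRing R]
    {A : Matrix n n R} (hA : A.IsSymm) (u v : n → R) :
    (u - v) ⬝ᵥ A *ᵥ (u - v) = u ⬝ᵥ A *ᵥ u - 2 * (v ⬝ᵥ A *ᵥ u) + v ⬝ᵥ A *ᵥ v := by
  have h : u ⬝ᵥ A *ᵥ v = v ⬝ᵥ A *ᵥ u := by
    rw [dotProduct_mulVec, ← mulVec_transpose, hA.eq, dotProduct_comm]
  rw [mulVec_sub, sub_dotProduct, dotProduct_sub, dotProduct_sub, h]
  ring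

theorem stmt_6 (d : ℕ) (hd : 1 ≤ d)
    (ρ : (Fin d → ℝ) → ℝ) (s : (Fin d → ℝ) → (Fin d → ℝ))
    (D : (Fin d → ℝ) → Matrix (Fin d) (Fin d) ℝ)
    -- `ρ` is an everywhere-positive C² probability density
    (hρpos : ∀ x, 0 < ρ x) (hρprob : (∫ x, ρ x) = 1)
    (hρ : ContDiff ℝ 2 ρ)
    -- `D` is C¹, symmetric positive semidefinite; `s` is C¹
    (hD : ∀ i j, ContDiff ℝ 1 (fun x => D x i j))
    (hDpsd : ∀ x, (D x).PosSemidef)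
    (hs : ContDiff ℝ 1 s)
    -- decay condition
    (hdecay : (∫ x, dvg (fun y => ρ y • (D y).mulVec (s y)) x) = 0)
    -- all integrals below are finite
    (hint1 : Integrable (fun x =>
      ((s x ⬝ᵥ (D x).mulVec (s x)) + 2 * dvg (fun y => (D y).mulVec (s y)) x) * ρ x))
    (hint2 : Integrable (fun x =>
      ((s x - grad (fun y => Real.log (ρ y)) x) ⬝ᵥ
        (D x).mulVec (s x - grad (fun y => Real.log (ρ y)) x)) * ρ x))
    (hint3 : Integrable (fun x =>
      (grad (fun y => Real.log (ρ y)) x ⬝ᵥ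
        (D x).mulVec (grad (fun y => Real.log (ρ y)) x)) * ρ x))
    (hint4 : Integrable (fun x =>
      ((D x).mulVec (s x) ⬝ᵥ grad (fun y => Real.log (ρ y)) x) * ρ x)) :
    (∫ x, ((s x ⬝ᵥ (D x).mulVec (s x))
        + 2 * dvg (fun y => (D y).mulVec (s y)) x) * ρ x)
      = (∫ x, ((s x - grad (fun y => Real.log (ρ y)) x) ⬝ᵥ
          (D x).mulVec (s x - grad (fun y => Real.log (ρ y)) x)) * ρ x)
        - ∫ x, (grad (fun y => Real.log (ρ y)) x ⬝ᵥ
            (D x).mulVec (grad (fun y => Real.log (ρ y)) x)) * ρ x := by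
  have key (x) : ((s x ⬝ᵥ (D x).mulVec (s x))
        + 2 * dvg (fun y => (D y).mulVec (s y)) x) * ρ x
      = ((s x - grad (fun y => Real.log (ρ y)) x) ⬝ᵥ
          (D x).mulVec (s x - grad (fun y => Real.log (ρ y)) x)) * ρ x
        - (grad (fun y => Real.log (ρ y)) x ⬝ᵥ
            (D x).mulVec (grad (fun y => Real.log (ρ y)) x)) * ρ x
        + 2 * dvg (fun y => ρ y • (D y).mulVec (s y)) x := by
    have hρx : DifferentiableAt ℝ ρ x := (hρ.differentiable (by norm_num)) x
    have hF : DifferentiableAt ℝ (fun y => (D y).mulVec (s y)) x := by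
      rw [differentiableAt_pi]
      intro i
      simp only [mulVec, dotProduct]
      refine DifferentiableAt.fun_sum fun j _ => ?_
      exact ((hD i j).differentiable (by norm_num) x).mul
        (differentiableAt_pi.1 (hs.differentiable (by norm_num) x) j)
    have hsymm : (D x).IsSymm := by
      simpa [IsSymm, IsHermitian, conjTranspose_eq_transpose_of_trivial] using (hDpsd x).isHermitian
    have hgrad : grad ρ x = ρ x • grad (fun y => Real.log (ρ y)) x := by
      rw [grad_log hρx (hρpos x).ne', smul_inv_smul₀ (hρpos x).ne']
    rw [dvg_smul hρx hF, sub_dotProduct_mulVec_sub hsymm, hgrad, smul_dotProduct, smul_eq_mul]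
    ring
  have hdiv : Integrable (fun x => 2 * dvg (fun y => ρ y • (D y).mulVec (s y)) x) := by
    refine (hint1.sub (hint2.sub hint3)).congr (ae_of_all _ fun x => ?_)
    simp only [Pi.sub_apply, key x]
    ring
  simp_rw [key]
  refine (integral_add (hint2.sub hint3) hdiv).trans ?_
  rw [integral_sub' hint2 hint3, integral_const_mul, hdecay, mul_zero, add_zero]
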